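/- Let Γ = (G,σ) be a signed graph and e = uv an edge of Γ. Then the adjacency characteristic polynomial satisfies φ(Γ,x) = φ(Γ-e,x) - φ(Γ-u-v,x) - 2·∑_{C ∈ C_e} σ(C)·φ(Γ-C,x), where C_e is the set of cycles of G containing e, σ(C) is the sign of cycle C, and Γ-C deletes all vertices of C. -/

import Mathlib

namespace Schwenk

open scoped Classical in
/-- `M` with the rows indexed by `S` replaced by unit rows. -/
noncomputable def del {V R : Type*} [CommRing R] (M : Matrix V V R) (S : Finset V) :
    Matrix V V R :=
  fun i => if i ∈ S then Pi.single i 1 else M i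

section
variable {V R : Type*} [Fintype V] [DecidableEq V] [CommRing R]

theorem del_apply (M : Matrix V V R) (S : Finset V) (i : V) :
    del M S i = if i ∈ S then Pi.single i 1 else M i := by
  unfold del; split_ifs <;> [(ext j; simp [Pi.single_apply]); rfl]

theorem del_empty (M : Matrix V V R) : del M ∅ = M := by
  ext i j; simp [del_apply]

theorem del_insert (M : Matrix V V R) (S : Finset V) (i : V) :
    del M (insert i S) = (del M S).updateRow i (Pi.single i 1) := by
  ext a b
  by_cases h : a = i
  · subst h; simp [del_apply]
  · simp [del_apply, Matrix.updateRow_ne h, h]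

theorem adj_del_self (M : Matrix V V R) (S : Finset V) (j : V) :
    (del M S).adjugate j j = (del M (insert j S)).det := by
  rw [Matrix.adjugate_apply, del_insert]

theorem adj_del_mem (M : Matrix V V R) (S : Finset V) (k j : V) (hk : k ∈ S) (hj : j ∉ S) :
    (del M S).adjugate k j = 0 := by
  have hkj : k ≠ j := fun h => hj (h ▸ hk)
  rw [Matrix.adjugate_apply]
  apply Matrix.det_zero_of_row_eq hkj
  rw [Matrix.updateRow_ne hkj, Matrix.updateRow_self, del_apply, if_pos hk]

theorem det_swap_rows (M : Matrix V V R) {i j : V} (h : i ≠ j) (a b : V → R) :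
    ((M.updateRow j a).updateRow i b).det = - ((M.updateRow j b).updateRow i a).det := by
  have := Matrix.det_permute (Equiv.swap i j) ((M.updateRow j b).updateRow i a)
  rw [Equiv.Perm.sign_swap h] at this
  simp only [Units.val_neg, Units.val_one, Int.cast_neg, Int.cast_one, neg_mul, one_mul] at this
  rw [← this]
  congr 1
  ext x y
  rw [Matrix.submatrix_apply]
  by_cases hx : x = i
  · subst hx; simp [Matrix.updateRow_ne h.symm]
  · by_cases hy : x = j
    · subst hy; simp [Matrix.updateRow_ne h.symm]
    · simp [Equiv.swap_apply_of_ne_of_ne hx hy, Matrix.updateRow_ne hx, Matrix.updateRow_ne hy]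

theorem det_updateRow_expand (M : Matrix V V R) (i : V) (a : V → R) :
    (M.updateRow i a).det = ∑ k, a k * (M.updateRow i (Pi.single k 1)).det := by
  have h : a = ∑ k, a k • (Pi.single k 1 : V → R) := by
    ext x; simp [Finset.sum_apply, Pi.single_apply]
  have h2 : M.transpose.cramer a = ∑ k, a k • M.transpose.cramer (Pi.single k 1) := by
    conv_lhs => rw [h]
    simp only [map_sum, map_smul]
  have h3 := congrFun h2 i
  simpa [Matrix.cramer_transpose_apply, Finset.sum_apply] using h3

theorem adj_del_step (M : Matrix V V R) (S : Finset V) (i j : V) (hi : i ∉ S) (hij : i ≠ j) :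
    (del M S).adjugate i j = - ∑ k, M i k * (del M (insert i S)).adjugate k j := by
  rw [Matrix.adjugate_apply]
  have h1 : (del M S).updateRow j (Pi.single i 1) =
      ((del M S).updateRow j (Pi.single i 1)).updateRow i (M i) := by
    ext a b
    by_cases h : a = i
    · subst h; simp [Matrix.updateRow_ne hij, del_apply, hi]
    · simp [Matrix.updateRow_ne h]
  rw [h1, det_updateRow_expand, ← Finset.sum_neg_distrib]
  refine Finset.sum_congr rfl fun k _ => ?_
  rw [det_swap_rows _ hij, Matrix.adjugate_apply, del_insert, mul_neg]
  rw [Matrix.updateRow_comm _ hij]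

theorem det_del (M : Matrix V V R) (S : Finset V) (p : V → Prop) [DecidablePred p]
    (hp : ∀ x, p x ↔ x ∉ S) :
    (del M S).det = (M.submatrix (fun x : {w // p w} => (x : V))
      (fun x : {w // p w} => (x : V))).det := by
  rw [Matrix.twoBlockTriangular_det (del M S) p]
  · have h2 : (Matrix.toSquareBlockProp (del M S) fun i => ¬ p i) = 1 := by
      ext ⟨a, ha⟩ ⟨b, hb⟩
      rw [hp, not_not] at ha
      simp [Matrix.toSquareBlockProp, del_apply, ha, Matrix.one_apply, Pi.single_apply, eq_comm]
    rw [h2, Matrix.det_one, mul_one]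
    congr 1
    ext ⟨a, ha⟩ ⟨b, hb⟩
    rw [hp] at ha
    simp [Matrix.toSquareBlockProp, del_apply, ha]
  · intro i hi j hj
    rw [hp, not_not] at hi
    rw [hp] at hj
    have : j ≠ i := fun h => hj (h ▸ hi)
    simp [del_apply, hi, this]

end

section
variable {V R : Type*} [Fintype V] [DecidableEq V] [CommRing R] (G : SimpleGraph V)
  [∀ i j, Fintype (G.Path i j)]

theorem sum_path_self (i : V) (f : G.Walk i i → R) : ∑ p : G.Path i i, f p.1 = f .nil := by
  rw [Fintype.sum_eq_single SimpleGraph.Path.nil]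
  · rfl
  · intro p hp
    exact absurd (SimpleGraph.Path.loop_eq p) hp

open scoped Classical in
theorem sum_path_step (i j : V) (hij : i ≠ j) (f : G.Walk i j → R) :
    ∑ p : G.Path i j, f p.1 = ∑ k, ∑ q : G.Path k j,
      if h : G.Adj i k ∧ i ∉ q.1.support then f (.cons h.1 q.1) else 0 := by
  rw [Finset.sum_sigma']
  symm
  rw [Finset.univ_sigma_univ]
  rw [← Finset.sum_filter_of_ne (p := fun x : (Σ k, G.Path k j) =>
    G.Adj i x.1 ∧ i ∉ x.2.1.support)]
  · refine Finset.sum_bij (fun x hx => ⟨.cons (Finset.mem_filter.1 hx).2.1 x.2.1,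
      (SimpleGraph.Walk.cons_isPath_iff _ _).2 ⟨x.2.2, (Finset.mem_filter.1 hx).2.2⟩⟩) ?_ ?_ ?_ ?_
    · simp
    · rintro ⟨k, q⟩ h ⟨k', q'⟩ h' he
      simp only [Subtype.mk.injEq, SimpleGraph.Walk.cons.injEq] at he
      obtain ⟨rfl, he⟩ := he
      have := Subtype.ext (eq_of_heq he)
      rw [this]
    · rintro ⟨p, hp⟩ -
      cases p with
      | nil => exact absurd rfl hij
      | cons h q =>
        rw [SimpleGraph.Walk.cons_isPath_iff] at hp
        exact ⟨⟨_, ⟨q, hp.1⟩⟩, by simpa using ⟨h, hp.2⟩, rfl⟩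
    · rintro x hx
      rw [dif_pos (Finset.mem_filter.1 hx).2]
  · intro x _ hx
    by_contra hc
    exact hx (dif_neg hc)

open scoped Classical in
theorem adj_path [DecidableRel G.Adj] (M : Matrix V V R) (w : Sym2 V → R)
    (hM : ∀ i j, i ≠ j → M i j = if G.Adj i j then - w s(i, j) else 0) (j : V) :
    ∀ (m : ℕ) (S : Finset V) (i : V), Sᶜ.card = m → i ∉ S → j ∉ S →
    (del M S).adjugate i j = ∑ p : G.Path i j,
      if ∀ x ∈ p.1.support, x ∉ S then
        (p.1.edges.map w).prod * (del M (S ∪ p.1.support.toFinset)).det else 0 := by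
  intro m
  induction m with
  | zero =>
    intro S i hS hi
    rw [Finset.card_eq_zero, Finset.compl_eq_empty_iff] at hS
    simp [hS] at hi
  | succ m ih =>
    intro S i hS hi hj
    by_cases hij : i = j
    · subst hij
      rw [sum_path_self G i (fun p => if ∀ x ∈ p.support, x ∉ S then
        (p.edges.map w).prod * (del M (S ∪ p.support.toFinset)).det else 0)]
      rw [adj_del_self]
      simp [hi, Finset.union_comm S]
    · rw [sum_path_step G i j hij (fun p => if ∀ x ∈ p.support, x ∉ S then
        (p.edges.map w).prod * (del M (S ∪ p.support.toFinset)).det else 0)]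
      rw [adj_del_step M S i j hi hij, ← Finset.sum_neg_distrib]
      refine Finset.sum_congr rfl fun k _ => ?_
      have hj' : j ∉ insert i S := by simp [hj, Ne.symm hij]
      by_cases hk : k ∈ insert i S
      · rw [adj_del_mem M _ k j hk hj', mul_zero, neg_zero]
        symm
        refine Finset.sum_eq_zero fun q _ => ?_
        split_ifs with h1 h2
        · exfalso
          rcases Finset.mem_insert.1 hk with rfl | hk
          · exact h1.1.ne rfl
          · exact h2 k (by simp) hk
        · rfl
        · rfl
      · have hc : (insert i S)ᶜ.card = m := by
          have := Finset.card_compl_add_card (insert i S)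
          have := Finset.card_compl_add_card S
          rw [Finset.card_insert_of_notMem hi] at *
          omega
        rw [ih (insert i S) k hc hk hj']
        have hik : i ≠ k := fun h => hk (by simp [h])
        rw [hM i k hik, Finset.mul_sum, ← Finset.sum_neg_distrib]
        refine Finset.sum_congr rfl fun q _ => ?_
        by_cases hA : G.Adj i k
        · by_cases hq : i ∈ q.1.support
          · rw [if_neg (fun h : ∀ x ∈ q.1.support, x ∉ insert i S => h i hq (by simp)),
              dif_neg (by simp [hq])]; simp
          · rw [dif_pos ⟨hA, hq⟩, if_pos hA]
            have e1 : (∀ x ∈ q.1.support, x ∉ insert i S) ↔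
                ∀ x ∈ (SimpleGraph.Walk.cons hA q.1).support, x ∉ S := by
              constructor
              · intro h x hx
                rw [SimpleGraph.Walk.support_cons, List.mem_cons] at hx
                rcases hx with rfl | hx
                · exact hi
                · exact fun h' => h x hx (Finset.mem_insert_of_mem h')
              · intro h x hx hx'
                rcases Finset.mem_insert.1 hx' with rfl | h'
                · exact hq hx
                · exact h x (by simp [hx]) h'
            have e2 : insert i S ∪ q.1.support.toFinset =
                S ∪ (SimpleGraph.Walk.cons hA q.1).support.toFinset := by
              ext x; simp
            rw [e2]
            simp only [e1]
            split_ifs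
            · simp [mul_assoc]
            · simp
        · rw [if_neg hA, dif_neg (fun h => hA h.1)]; simp

theorem path_edge (u v : V) (huv : G.Adj u v) (p : G.Walk v u) (hp : p.IsPath)
    (h : s(u, v) ∈ p.edges) : p = .cons huv.symm .nil := by
  cases p with
  | nil => simp at h
  | cons h' q =>
    rw [SimpleGraph.Walk.cons_isPath_iff] at hp
    rw [SimpleGraph.Walk.edges_cons, List.mem_cons] at h
    rcases h with h | h
    · rw [Sym2.eq_swap, Sym2.congr_right] at h
      subst h
      rw [SimpleGraph.Walk.nil_iff_eq_nil.1 (SimpleGraph.Walk.isPath_iff_nil.1 hp.1)]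
    · exact absurd (SimpleGraph.Walk.snd_mem_support_of_mem_edges q h) hp.2

end

end Schwenk

open scoped Classical in
/-- Schwenk's edge formula for signed graphs: For an edge e = uv of a signed
graph Γ, φ(Γ,x) = φ(Γ-e,x) - φ(Γ-u-v,x) - 2·∑_{C ∈ C_e} σ(C)·φ(Γ-C,x), where C_e is the set
of cycles through e (parametrized here by the paths p from v to u avoiding e, each such path
giving the cycle obtained by adding the edge e), σ(C) is the product of the edge signs of C,
and Γ-C deletes all vertices of C. -/
theorem stmt_16 {n : ℕ} (G : SimpleGraph (Fin n)) [DecidableRel G.Adj]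
    (s : Sym2 (Fin n) → ℝ)
    (hsign : ∀ e ∈ G.edgeSet, s e = 1 ∨ s e = -1)
    (A : Matrix (Fin n) (Fin n) ℝ)
    (hA : ∀ i j, A i j = if G.Adj i j then s s(i, j) else 0)
    (u v : Fin n) (huv : G.Adj u v)
    (A' : Matrix (Fin n) (Fin n) ℝ)
    (hA' : ∀ i j, A' i j = if (i = u ∧ j = v) ∨ (i = v ∧ j = u) then 0 else A i j) :
    A.charpoly =
      A'.charpoly
      - (A.submatrix (fun x : {w : Fin n // w ≠ u ∧ w ≠ v} => (x : Fin n))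
          (fun x : {w : Fin n // w ≠ u ∧ w ≠ v} => (x : Fin n))).charpoly
      - 2 * ∑ p ∈ Finset.univ.filter (fun p : G.Path v u => s(u, v) ∉ p.1.edges),
          Polynomial.C (((SimpleGraph.Walk.cons huv p.1).edges.map s).prod) *
            (A.submatrix
              (fun x : {w : Fin n // w ∉ (SimpleGraph.Walk.cons huv p.1).support} => (x : Fin n))
              (fun x : {w : Fin n // w ∉ (SimpleGraph.Walk.cons huv p.1).support} => (x : Fin n))).charpoly := by
  set M := A.charmatrix with hMdef
  have hMo : ∀ i j, i ≠ j → M i j =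
      if G.Adj i j then - (Polynomial.C (s s(i, j))) else 0 := by
    intro i j hij
    rw [hMdef, Matrix.charmatrix_apply_ne _ _ _ hij, hA]
    split_ifs <;> simp
  have hne : u ≠ v := huv.ne
  have hsub : ∀ (p : Fin n → Prop) (S : Finset (Fin n)) (hp : ∀ x, p x ↔ x ∉ S)
      [i1 : Fintype {w : Fin n // p w}] [i2 : DecidableEq {w : Fin n // p w}],
      (A.submatrix (fun x : {w : Fin n // p w} => (x : Fin n))
        (fun x : {w : Fin n // p w} => (x : Fin n))).charpoly = (Schwenk.del M S).det := by
    intro p S hp i1 i2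
    rw [Schwenk.det_del M S p hp, Matrix.charpoly]
    convert rfl using 2
    ext1 a b
    by_cases hab : a = b
    · subst hab; simp [hMdef, Matrix.charmatrix_apply_eq]
    · have : (a : Fin n) ≠ b := fun h => hab (Subtype.ext h)
      simp [hMdef, Matrix.charmatrix_apply_ne _ _ _ hab, Matrix.charmatrix_apply_ne _ _ _ this]
  have hadj := Schwenk.adj_path G M (fun e => Polynomial.C (s e)) hMo u _ ∅ v rfl
    (by simp) (by simp)
  rw [Schwenk.del_empty] at hadj
  have hsymm : M.adjugate u v = M.adjugate v u := by
    have : M.transpose = M := by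
      ext1 i j
      by_cases h : i = j
      · subst h; rfl
      · rw [Matrix.transpose_apply, hMo _ _ h, hMo _ _ (Ne.symm h), Sym2.eq_swap]
        simp only [G.adj_comm]
    conv_lhs => rw [← this, ← Matrix.adjugate_transpose, Matrix.transpose_apply]
  set a : Polynomial ℝ := Polynomial.C (s s(u, v)) with ha
  have haa : a * a = 1 := by
    rw [ha, ← Polynomial.C_mul]
    rcases hsign s(u, v) huv with h | h <;> simp [h]
  set D := (Schwenk.del M {u, v}).det with hD
  have hdet : A'.charpoly = A.charpoly + a * M.adjugate v u + a * M.adjugate u v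
      - a * a * D := by
    have hM' : A'.charmatrix = (M.updateRow v (M v + a • Pi.single u 1)).updateRow u
        (M u + a • Pi.single v 1) := by
      ext1 i j
      by_cases hi : i = u
      · subst hi
        rw [Matrix.updateRow_self]
        by_cases hj : j = i
        · subst hj; simp [hMdef, Matrix.charmatrix_apply_eq, hA', hne]
        · rw [Matrix.charmatrix_apply_ne _ _ _ (Ne.symm hj), hA']
          by_cases hjv : j = v
          · subst hjv; simp [hMo _ _ hne, huv, ha]
          · simp [hMdef, Matrix.charmatrix_apply_ne _ _ _ (Ne.symm hj), hjv, hne]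
      · rw [Matrix.updateRow_ne hi]
        by_cases hi' : i = v
        · subst hi'
          rw [Matrix.updateRow_self]
          by_cases hj : j = i
          · subst hj; simp [hMdef, Matrix.charmatrix_apply_eq, hA', hi]
          · rw [Matrix.charmatrix_apply_ne _ _ _ (Ne.symm hj), hA']
            by_cases hjv : j = u
            · subst hjv; simp [hMo _ _ hi, huv.symm, ha, Sym2.eq_swap]
            · simp [hMdef, Matrix.charmatrix_apply_ne _ _ _ (Ne.symm hj), hjv, hi]
        · rw [Matrix.updateRow_ne hi', hMdef]
          simp [Matrix.charmatrix_apply, hA', hi, hi']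
    rw [Matrix.charpoly, hM', Matrix.det_updateRow_add, Matrix.det_updateRow_smul,
      Matrix.updateRow_comm _ hne.symm, Matrix.updateRow_comm _ hne.symm,
      Matrix.det_updateRow_add, Matrix.det_updateRow_smul,
      Matrix.det_updateRow_add, Matrix.det_updateRow_smul, 
      Matrix.updateRow_eq_self, Matrix.updateRow_eq_self]
    have e1 : ((M.updateRow u (Pi.single v 1)).updateRow v (M v)) =
        M.updateRow u (Pi.single v 1) := by
      rw [Matrix.updateRow_comm _ hne, Matrix.updateRow_eq_self]
    have e2 : ((M.updateRow u (Pi.single v 1)).updateRow v (Pi.single u 1)).det = - D := by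
      rw [Schwenk.det_swap_rows _ hne.symm, hD, Schwenk.del_insert, ← insert_empty_eq v,
        Schwenk.del_insert, Schwenk.del_empty, Matrix.updateRow_comm _ hne]
    rw [e1, e2, ← Matrix.adjugate_apply, ← Matrix.adjugate_apply, Matrix.charpoly]
    ring
  have hc : M.adjugate v u = a * D + ∑ p ∈ Finset.univ.filter
      (fun p : G.Path v u => s(u, v) ∉ p.1.edges),
      (p.1.edges.map (fun e => Polynomial.C (s e))).prod *
        (Schwenk.del M p.1.support.toFinset).det := by
    rw [hadj, ← Finset.sum_filter_add_sum_filter_not _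
      (fun p : G.Path v u => s(u, v) ∈ p.1.edges)]
    congr 1
    · rw [Finset.sum_eq_single (⟨.cons huv.symm .nil, by simp [hne.symm]⟩ : G.Path v u)]
      · simp [ha, hD, Sym2.eq_swap, Finset.pair_comm]
      · intro p hp hne'
        exact absurd (Subtype.ext (Schwenk.path_edge G u v huv p.1 p.2
          (Finset.mem_filter.1 hp).2)) hne'
      · simp [Sym2.eq_swap]
    · simp
  rw [hsub _ {u, v} (by simp), ← hD]
  have hsum : ∀ p : G.Path v u,
      Polynomial.C (((SimpleGraph.Walk.cons huv p.1).edges.map s).prod) *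
            (A.submatrix
              (fun x : {w : Fin n // w ∉ (SimpleGraph.Walk.cons huv p.1).support} => (x : Fin n))
              (fun x : {w : Fin n // w ∉ (SimpleGraph.Walk.cons huv p.1).support} => (x : Fin n))).charpoly
      = a * ((p.1.edges.map (fun e => Polynomial.C (s e))).prod *
        (Schwenk.del M p.1.support.toFinset).det) := by
    intro p
    rw [hsub _ p.1.support.toFinset (by
      intro x
      have : u ∈ p.1.support := p.1.end_mem_support
      simp only [SimpleGraph.Walk.support_cons, List.mem_cons, List.mem_toFinset]
      constructor
      · tauto
      · rintro h (rfl | h')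
        · exact h this
        · exact h h')]
    simp [ha, mul_assoc, Polynomial.C_mul, map_list_prod, Function.comp_def]
  simp only [hsum]
  rw [← Finset.mul_sum]
  rw [hdet, hsymm, hc]
  linear_combination (-D) * haa
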